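/- arXiv:math/0410419 — 4 statements merged into one kernel-verified Lean document; each statement's English description precedes it below -/
import Mathlib

section
/- Let V be a vector space over ℝ and let E_1, …, E_d be pairwise commuting idempotent linear operators on V. Suppose f ∈ V is written as f = ∑_{S ⊆ {1,…,d}} g_S where, for each S, the element g_S satisfies E_γ g_S = 0 for every γ ∈ S and E_γ g_S = g_S for every γ ∉ S. Then necessarily g_S = P_S f for every S, where P_S = (∏_{α∈S} (I − E_α)) ∘ (∏_{α∉S} E_α). In other words, the ANOVA decomposition subject to these side conditions is unique. -/
/-- The ANOVA projection operator `P_S = (∏_{α∈S} (I − E_α)) ∘ (∏_{α∉S} E_α)`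
associated with a family of pairwise commuting operators `E`. -/
noncomputable def anovaProj {V : Type*} [AddCommGroup V] [Module ℝ V] {d : ℕ}
    (E : Fin d → Module.End ℝ V) (hcomm : ∀ α β, E α * E β = E β * E α)
    (S : Finset (Fin d)) : Module.End ℝ V :=
  (S.noncommProd (fun α => 1 - E α)
      (fun a _ b _ _ =>
        Commute.sub_left (Commute.one_left _)
          (Commute.sub_right (Commute.one_right _) (hcomm a b)))) *
  (Sᶜ.noncommProd E (fun a _ b _ _ => hcomm a b))

/-- A product of commuting operators acts on a common eigenvector by the product of eigenvalues. -/
theorem noncommProd_apply_eigen {V : Type*} [AddCommGroup V] [Module ℝ V] {ι : Type*}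
    [DecidableEq ι] (F : ι → Module.End ℝ V) (c : ι → ℝ) (v : V) (T : Finset ι)
    (hc : (T : Set ι).Pairwise (Function.onFun Commute F))
    (h : ∀ a ∈ T, F a v = c a • v) :
    T.noncommProd F hc v = (∏ a ∈ T, c a) • v := by
  induction T using Finset.induction_on with
  | empty => simp
  | insert a T ha ih =>
    rw [Finset.noncommProd_insert_of_notMem _ _ _ _ ha, Module.End.mul_apply,
      ih _ (fun b hb => h b (Finset.mem_insert_of_mem hb)), map_smul,
      h a (Finset.mem_insert_self a T), smul_smul, Finset.prod_insert ha, mul_comm]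

/-- Uniqueness of the ANOVA decomposition: if `f = ∑_S g_S` where each `g_S`
satisfies `E_γ g_S = 0` for `γ ∈ S` and `E_γ g_S = g_S` for `γ ∉ S`, then
necessarily `g_S = P_S f` for every `S`. -/
theorem anova_decomposition_unique {V : Type*} [AddCommGroup V] [Module ℝ V] {d : ℕ}
    (E : Fin d → Module.End ℝ V)
    (hidem : ∀ α, E α * E α = E α)
    (hcomm : ∀ α β, E α * E β = E β * E α)
    (f : V) (g : Finset (Fin d) → V)
    (hsum : f = ∑ S : Finset (Fin d), g S)
    (hside : ∀ (S : Finset (Fin d)) (γ : Fin d),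
      (γ ∈ S → E γ (g S) = 0) ∧ (γ ∉ S → E γ (g S) = g S)) :
    ∀ S : Finset (Fin d), g S = anovaProj E hcomm S f := by
  intro S
  have key : ∀ T, anovaProj E hcomm S (g T) = if T = S then g T else 0 := by
    intro T
    have hc1 : (S : Set (Fin d)).Pairwise (Function.onFun Commute (fun a => 1 - E a)) :=
      fun a _ b _ _ => Commute.sub_left (Commute.one_left _)
          (Commute.sub_right (Commute.one_right _) (hcomm a b))
    have hc2 : ((Sᶜ : Finset (Fin d)) : Set (Fin d)).Pairwise (Function.onFun Commute E) :=
      fun a _ b _ _ => hcomm a b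
    have hP : anovaProj E hcomm S =
        S.noncommProd (fun a => 1 - E a) hc1 * Sᶜ.noncommProd E hc2 := rfl
    rw [hP, Module.End.mul_apply,
      noncommProd_apply_eigen E (fun a => if a ∈ T then 0 else 1) (g T) Sᶜ hc2 ?_, map_smul,
      noncommProd_apply_eigen (fun a => 1 - E a) (fun a => if a ∈ T then 1 else 0) (g T) S hc1 ?_]
    · split_ifs with hTS
      · subst hTS
        rw [Finset.prod_eq_one, Finset.prod_eq_one, one_smul, one_smul]
        · intro a ha
          simp [ha]
        · intro a ha
          simp [Finset.mem_compl.mp ha]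
      · by_cases hsub : S ⊆ T
        · obtain ⟨a, haT, haS⟩ : ∃ a ∈ T, a ∉ S := by
            by_contra! hcon
            exact hTS (Finset.Subset.antisymm hcon hsub)
          rw [Finset.prod_eq_zero (Finset.mem_compl.mpr haS) (by simp [haT]), zero_smul]
        · obtain ⟨a, haS, haT⟩ := Finset.not_subset.mp hsub
          rw [Finset.prod_eq_zero (s := S) haS (by simp [haT]), zero_smul, smul_zero]
    · intro a _
      by_cases ha : a ∈ T
      · simp [ha, (hside T a).1 ha]
      · simp [ha, (hside T a).2 ha]
    · intro a _
      by_cases ha : a ∈ T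
      · simp [ha, (hside T a).1 ha]
      · simp [ha, (hside T a).2 ha]
  rw [hsum, map_sum, Finset.sum_congr rfl (fun T _ => key T)]
  simp
end

section
/- Let H be a real Hilbert space, let L_1, …, L_n be continuous linear functionals on H with Riesz representers η_1, …, η_n ∈ H (so L_i f = ⟨η_i, f⟩ for all f ∈ H), let y_1, …, y_n ∈ ℝ, and let λ > 0. Then the functional J(f) = (1/n) ∑_{i=1}^n (y_i − ⟨η_i, f⟩)² + λ ‖f‖² attains a unique minimizer f̂ over H, and f̂ lies in the span of {η_1, …, η_n}. -/
open RealInnerProductSpace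

/-- The penalized least squares functional
`J(f) = (1/n) ∑ᵢ (yᵢ − ⟨ηᵢ, f⟩)² + λ‖f‖²`. -/
noncomputable def penLS {H : Type*} [NormedAddCommGroup H] [InnerProductSpace ℝ H]
    (n : ℕ) (η : Fin n → H) (y : Fin n → ℝ) (lam : ℝ) (f : H) : ℝ :=
  (1 / (n : ℝ)) * ∑ i, (y i - ⟪η i, f⟫)^2 + lam * ‖f‖^2

/-- Representer theorem: the penalized least squares functional
`J(f) = (1/n) ∑ᵢ (yᵢ − ⟨ηᵢ, f⟩)² + λ‖f‖²` with `λ > 0` attains a unique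
minimizer over the Hilbert space `H`, and the minimizer lies in the span of
the representers `η₁, …, η_n`. -/
theorem representer_theorem {H : Type*} [NormedAddCommGroup H]
    [InnerProductSpace ℝ H] [CompleteSpace H]
    (n : ℕ) (η : Fin n → H) (y : Fin n → ℝ) (lam : ℝ) (hlam : 0 < lam) :
    ∃ fhat ∈ Submodule.span ℝ (Set.range η),
      (∀ g : H, penLS n η y lam fhat ≤ penLS n η y lam g) ∧
      (∀ g : H, (∀ h : H, penLS n η y lam g ≤ penLS n η y lam h) → g = fhat) := by
  obtain ⟨c, hc⟩ : ∃ c : Fin n → ℝ, ∀ i,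
      lam * c i + (1 / (n : ℝ)) * ⟪η i, ∑ j, c j • η j⟫ = (1 / (n : ℝ)) * y i := by
    let T : (Fin n → ℝ) →ₗ[ℝ] (Fin n → ℝ) :=
      { toFun := fun c i => lam * c i + (1 / (n : ℝ)) * ⟪η i, ∑ j, c j • η j⟫
        map_add' := by
          intro a b
          ext i
          simp only [Pi.add_apply, add_smul, Finset.sum_add_distrib, inner_add_right]
          ring
        map_smul' := by
          intro r a
          ext i
          simp only [Pi.smul_apply, smul_eq_mul, mul_smul, ← Finset.smul_sum,
            inner_smul_right, RingHom.id_apply]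
          ring }
    have hT : Function.Injective T := by
      rw [injective_iff_map_eq_zero]
      intro a ha
      have h1 : ∀ i, lam * a i + (1 / (n : ℝ)) * ⟪η i, ∑ j, a j • η j⟫ = 0 :=
        fun i => congrFun ha i
      have h2 : lam * ∑ i, a i ^ 2
          + (1 / (n : ℝ)) * ⟪∑ j, a j • η j, ∑ j, a j • η j⟫ = 0 := by
        conv_lhs => rw [sum_inner]
        rw [Finset.mul_sum, Finset.mul_sum, ← Finset.sum_add_distrib]
        apply Finset.sum_eq_zero
        intro i _
        rw [real_inner_smul_left]
        linear_combination a i * h1 i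
      have h3 : 0 ≤ (1 / (n : ℝ)) * ⟪∑ j, a j • η j, ∑ j, a j • η j⟫ :=
        mul_nonneg (by positivity) real_inner_self_nonneg
      have h4 : 0 ≤ ∑ i, a i ^ 2 := Finset.sum_nonneg fun i _ => sq_nonneg _
      have h5 : ∑ i, a i ^ 2 = 0 := by
        by_contra h
        have : 0 < lam * ∑ i, a i ^ 2 := mul_pos hlam (lt_of_le_of_ne h4 (Ne.symm h))
        linarith
      ext i
      have := (Finset.sum_eq_zero_iff_of_nonneg (fun i _ => sq_nonneg (a i))).1 h5 i
        (Finset.mem_univ i)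
      simpa using this
    obtain ⟨c, hc⟩ := (LinearMap.injective_iff_surjective.1 hT)
      (fun i => (1 / (n : ℝ)) * y i)
    exact ⟨c, fun i => congrFun hc i⟩
  set f : H := ∑ j, c j • η j with hf
  have key : ∀ g : H, penLS n η y lam g = penLS n η y lam f
      + ((1 / (n : ℝ)) * ∑ i, ⟪η i, g - f⟫ ^ 2 + lam * ‖g - f‖ ^ 2) := by
    intro g
    obtain ⟨d, rfl⟩ : ∃ d, g = f + d := ⟨g - f, by abel⟩
    have hfd : ⟪f, d⟫ = ∑ i, c i * ⟪η i, d⟫ := by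
      rw [hf, sum_inner]
      simp only [real_inner_smul_left]
    have hcross : lam * ⟪f, d⟫
        = (1 / (n : ℝ)) * ∑ i, (y i - ⟪η i, f⟫) * ⟪η i, d⟫ := by
      rw [hfd, Finset.mul_sum, Finset.mul_sum]
      apply Finset.sum_congr rfl
      intro i _
      linear_combination ⟪η i, d⟫ * hc i
    have hsum : ∑ i, (y i - ⟪η i, f + d⟫) ^ 2 = ∑ i, (y i - ⟪η i, f⟫) ^ 2
        - 2 * ∑ i, (y i - ⟪η i, f⟫) * ⟪η i, d⟫ + ∑ i, ⟪η i, d⟫ ^ 2 := by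
      rw [Finset.mul_sum, ← Finset.sum_sub_distrib, ← Finset.sum_add_distrib]
      apply Finset.sum_congr rfl
      intro i _
      rw [inner_add_right]
      ring
    unfold penLS
    rw [hsum, norm_add_sq_real, add_sub_cancel_left]
    linear_combination 2 * hcross
  have hnn : ∀ g : H, 0 ≤ (1 / (n : ℝ)) * ∑ i, ⟪η i, g - f⟫ ^ 2 := fun g =>
    mul_nonneg (by positivity) (Finset.sum_nonneg fun i _ => sq_nonneg _)
  refine ⟨f, ?_, ?_, ?_⟩
  · exact Submodule.sum_mem _ fun j _ =>
      Submodule.smul_mem _ _ (Submodule.subset_span ⟨j, rfl⟩)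
  · intro g
    have h2 : 0 ≤ lam * ‖g - f‖ ^ 2 := by positivity
    linarith [key g, hnn g]
  · intro g hg
    by_contra hne
    have hpos : 0 < ‖g - f‖ := norm_pos_iff.2 (sub_ne_zero.2 hne)
    have h2 : 0 < lam * ‖g - f‖ ^ 2 := by positivity
    linarith [key g, hnn g, hg f]
end

section
/- Let p ∈ (0,1) with p ≠ 1/2. Then the function R(f) = p·max(1−f, 0) + (1−p)·max(1+f, 0), f ∈ ℝ, attains a unique minimum over ℝ, and the unique minimizer is f* = 1 if p > 1/2 and f* = −1 if p < 1/2; that is, f* = sign(2p − 1). -/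
/-- The conditional expected hinge loss of the two-category SVM,
`R(f) = p (1 − f)₊ + (1 − p) (1 + f)₊`. -/
noncomputable def hingeRisk (p f : ℝ) : ℝ :=
  p * max (1 - f) 0 + (1 - p) * max (1 + f) 0

/-- For `p ∈ (0,1)` with `p ≠ 1/2`, the conditional expected hinge loss
`R(f) = p (1 − f)₊ + (1 − p)(1 + f)₊` attains a unique minimum over `ℝ`, and
the unique minimizer is `f* = 1` if `p > 1/2` and `f* = −1` if `p < 1/2`;
that is, `f* = sign(2p − 1)`. -/
theorem svm_target_is_bayes_rule (p : ℝ) (hp : p ∈ Set.Ioo (0 : ℝ) 1)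
    (hne : p ≠ 1 / 2) :
    (∀ g : ℝ, hingeRisk p (if 1 / 2 < p then 1 else -1) ≤ hingeRisk p g) ∧
    (∀ g : ℝ, (∀ h : ℝ, hingeRisk p g ≤ hingeRisk p h) →
      g = (if 1 / 2 < p then 1 else -1)) := by
  obtain ⟨h0, h1⟩ := hp
  have key : ∀ g : ℝ, g ≠ (if 1 / 2 < p then 1 else -1) →
      hingeRisk p (if 1 / 2 < p then 1 else -1) < hingeRisk p g := by
    intro g hg
    unfold hingeRisk
    split_ifs at hg ⊢ with h
    · have e1 : max (1 - (1 : ℝ)) 0 = 0 := by norm_num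
      have e2 : max (1 + (1 : ℝ)) 0 = 2 := by norm_num
      rw [e1, e2]
      rcases lt_or_gt_of_ne hg with hlt | hgt
      · rw [max_eq_left (by linarith : (0 : ℝ) ≤ 1 - g)]
        rcases le_total (1 + g) 0 with hm | hm
        · rw [max_eq_right hm]
          nlinarith
        · rw [max_eq_left hm]
          nlinarith
      · rw [max_eq_right (by linarith : 1 - g ≤ 0), max_eq_left (by linarith : (0 : ℝ) ≤ 1 + g)]
        nlinarith
    · have h' : p < 1 / 2 := lt_of_le_of_ne (not_lt.mp h) hne
      have e1 : max (1 - (-1 : ℝ)) 0 = 2 := by norm_num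
      have e2 : max (1 + (-1 : ℝ)) 0 = 0 := by norm_num
      rw [e1, e2]
      rcases lt_or_gt_of_ne hg with hlt | hgt
      · rw [max_eq_left (by linarith : (0 : ℝ) ≤ 1 - g), max_eq_right (by linarith : 1 + g ≤ 0)]
        nlinarith
      · rw [max_eq_left (by linarith : (0 : ℝ) ≤ 1 + g)]
        rcases le_total (1 - g) 0 with hm | hm
        · rw [max_eq_right hm]
          nlinarith
        · rw [max_eq_left hm]
          nlinarith
  constructor
  · intro g
    by_cases hg : g = (if 1 / 2 < p then 1 else -1)
    · rw [← hg]
    · exact (key g hg).le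
  · intro g hmin
    by_contra hg
    exact absurd (hmin _) (not_le.mpr (key g hg))
end

section
/- Let k ≥ 2 and let p = (p_1,…,p_k) satisfy p_j > 0 for all j and ∑_{j=1}^k p_j = 1, and suppose there is a unique index j* with p_{j*} > p_j for all j ≠ j*. Then over the constraint set C = { f ∈ ℝ^k : ∑_{r=1}^k f_r = 0 }, the function R(f) = ∑_{r=1}^k (1 − p_r) · max( f_r + 1/(k−1), 0 ) attains its minimum, and the unique minimizer is the vector f* with f*_{j*} = 1 and f*_r = −1/(k−1) for every r ≠ j*. -/
/-- The conditional expected hinge risk of the multicategory SVM,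
`R(f) = ∑_r (1 − p_r) (f_r + 1/(k−1))₊`. -/
noncomputable def msvmRisk (k : ℕ) (p f : Fin k → ℝ) : ℝ :=
  ∑ r, (1 - p r) * max (f r + 1 / ((k : ℝ) - 1)) 0

/-- The population target of the multicategory SVM: if the class probabilities
`p₁,…,p_k` are positive, sum to one, and have a unique maximizer `j*`, then
over the constraint set `{f : ∑_r f_r = 0}` the risk
`R(f) = ∑_r (1 − p_r)(f_r + 1/(k−1))₊` attains its minimum, and the unique
minimizer is the vector `f*` with `f*_{j*} = 1` and `f*_r = −1/(k−1)` for
`r ≠ j*`. -/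
theorem msvm_target (k : ℕ) (hk : 2 ≤ k)
    (p : Fin k → ℝ) (hp : ∀ j, 0 < p j) (hsum : ∑ j, p j = 1)
    (jstar : Fin k) (hmax : ∀ j, j ≠ jstar → p j < p jstar) :
    (∑ r, (fun r => if r = jstar then (1 : ℝ) else -1 / ((k : ℝ) - 1)) r = 0) ∧
    (∀ g : Fin k → ℝ, ∑ r, g r = 0 →
      msvmRisk k p (fun r => if r = jstar then (1 : ℝ) else -1 / ((k : ℝ) - 1)) ≤
        msvmRisk k p g) ∧
    (∀ g : Fin k → ℝ, ∑ r, g r = 0 →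
      (∀ h : Fin k → ℝ, ∑ r, h r = 0 → msvmRisk k p g ≤ msvmRisk k p h) →
      g = fun r => if r = jstar then (1 : ℝ) else -1 / ((k : ℝ) - 1)) := by
  have hk1 : (0 : ℝ) < (k : ℝ) - 1 := by
    have : (2 : ℝ) ≤ k := by exact_mod_cast hk
    linarith
  have hsub : ∀ c : ℝ, ∑ r : Fin k, (if r = jstar then (0 : ℝ) else c) = ((k : ℝ) - 1) * c := by
    intro c
    have h1 : ∀ r : Fin k, (if r = jstar then (0 : ℝ) else c)
        = c - (if r = jstar then c else 0) := by
      intro r; split_ifs <;> simp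
    rw [Finset.sum_congr rfl (fun r _ => h1 r), Finset.sum_sub_distrib]
    simp
    ring
  have hF : (∑ r, (fun r => if r = jstar then (1 : ℝ) else -1 / ((k : ℝ) - 1)) r = 0) := by
    have h1 : ∀ r : Fin k, (if r = jstar then (1 : ℝ) else -1 / ((k : ℝ) - 1))
        = (if r = jstar then 1 else 0) + (if r = jstar then (0 : ℝ) else -1 / ((k : ℝ) - 1)) := by
      intro r; split_ifs <;> simp
    show ∑ r : Fin k, (if r = jstar then (1 : ℝ) else -1 / ((k : ℝ) - 1)) = 0
    rw [Finset.sum_congr rfl (fun r _ => h1 r), Finset.sum_add_distrib, hsub]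
    simp
    field_simp
    ring
  have hp1 : 0 < 1 - p jstar := by
    have : ∃ j : Fin k, j ≠ jstar := by
      haveI : Nontrivial (Fin k) := Fin.nontrivial_iff_two_le.mpr hk
      exact exists_ne jstar
    obtain ⟨j, hj⟩ := this
    have h2 := Finset.add_le_sum (s := Finset.univ) (f := p) (fun i _ => (hp i).le)
      (Finset.mem_univ j) (Finset.mem_univ jstar) hj
    have := hp j
    linarith
  -- the excess risk as a sum of nonnegative terms
  have hdec : ∀ g : Fin k → ℝ, ∑ r, g r = 0 → msvmRisk k p g
      = (1 - p jstar) * ((k : ℝ) * (1 / ((k : ℝ) - 1)))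
        + ∑ r, ((1 - p r) * max (g r + 1 / ((k : ℝ) - 1)) 0
          - (1 - p jstar) * (g r + 1 / ((k : ℝ) - 1))) := by
    intro g hg
    rw [Finset.sum_sub_distrib, ← Finset.mul_sum, Finset.sum_add_distrib, hg]
    unfold msvmRisk
    simp
  have hle : ∀ r, p r ≤ p jstar := by
    intro r
    by_cases h : r = jstar
    · rw [h]
    · exact (hmax r h).le
  have hnn : ∀ (r : Fin k) (u : ℝ), 0 ≤ (1 - p r) * max u 0 - (1 - p jstar) * u := by
    intro r u
    have := hle r
    rcases le_total 0 u with h | h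
    · rw [max_eq_left h]; nlinarith
    · rw [max_eq_right h]; nlinarith
  have hz : ∀ (r : Fin k) (u : ℝ), r ≠ jstar →
      (1 - p r) * max u 0 - (1 - p jstar) * u = 0 → u = 0 := by
    intro r u hr h0
    have := hmax r hr
    rcases le_total 0 u with h | h
    · rw [max_eq_left h] at h0; nlinarith
    · rw [max_eq_right h] at h0; nlinarith
  have hFR : msvmRisk k p (fun r => if r = jstar then (1 : ℝ) else -1 / ((k : ℝ) - 1))
      = (1 - p jstar) * ((k : ℝ) * (1 / ((k : ℝ) - 1))) := by
    rw [hdec _ hF, Finset.sum_eq_zero, add_zero]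
    intro r _
    by_cases h : r = jstar
    · have h3 : (0 : ℝ) ≤ 1 + 1 / ((k : ℝ) - 1) := by positivity
      simp only [h, if_true]
      rw [max_eq_left h3]; ring
    · have h3 : -1 / ((k : ℝ) - 1) + 1 / ((k : ℝ) - 1) = 0 := by ring
      simp only [h, if_false, h3]
      simp
  refine ⟨hF, ?_, ?_⟩
  · intro g hg
    rw [hFR, hdec g hg]
    have := Finset.sum_nonneg (s := Finset.univ)
      (fun r _ => hnn r (g r + 1 / ((k : ℝ) - 1)))
    linarith
  · intro g hg hmin
    have h1 := hmin _ hF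
    rw [hFR, hdec g hg] at h1
    have h2 := Finset.sum_nonneg (s := Finset.univ)
      (fun r _ => hnn r (g r + 1 / ((k : ℝ) - 1)))
    have h3 := (Finset.sum_eq_zero_iff_of_nonneg (s := Finset.univ)
      (fun r _ => hnn r (g r + 1 / ((k : ℝ) - 1)))).mp (by linarith)
    have h4 : ∀ r, r ≠ jstar → g r = -1 / ((k : ℝ) - 1) := by
      intro r hr
      have h5 := hz r _ hr (h3 r (Finset.mem_univ r))
      rw [neg_div]; linarith
    have h6 : g jstar = 1 := by
      have e1 := Finset.add_sum_erase Finset.univ g (Finset.mem_univ jstar)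
      have e2 := Finset.add_sum_erase Finset.univ
        (fun r => if r = jstar then (1 : ℝ) else -1 / ((k : ℝ) - 1)) (Finset.mem_univ jstar)
      rw [hF] at e2
      rw [hg] at e1
      have e3 : ∑ r ∈ Finset.univ.erase jstar, g r = ∑ r ∈ Finset.univ.erase jstar,
          (fun r => if r = jstar then (1 : ℝ) else -1 / ((k : ℝ) - 1)) r := by
        apply Finset.sum_congr rfl
        intro r hr
        have hr' := Finset.ne_of_mem_erase hr
        simp only [hr', if_false]
        exact h4 r hr'
      rw [e3] at e1
      simp only [if_true] at e1 e2
      linarith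
    funext r
    by_cases h : r = jstar
    · simp only [h, if_true]; exact h6
    · simp only [h, if_false]; exact h4 r h
end
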